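/- arXiv:1101.1437 — 3 statements merged into one kernel-verified Lean document; each statement's English description precedes it below -/
import Mathlib

section
/- Let d ≥ 1 and let Λ ⊂ Z^d be finite, and let ξ ∈ {0,1,…,2d}^Λ. Define the burning algorithm by U_0 = Λ, B_1 = {x ∈ U_0 : ξ_x = 2d}, U_1 = Λ ∖ B_1, and inductively for i ≥ 2: B_i = {x ∈ U_{i−1} : ξ_x ≥ #{y ∈ U_{i−1} : y ∼ x}} and U_i = U_{i−1} ∖ B_i. Then there exists i ≥ 1 with U_i = ∅ if and only if ξ is allowed. -/
/- STATEMENT 0: The burning test terminates if and only if the configuration is allowed. -/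

namespace Sandpile0

/-- The lattice `ℤ^d`. -/
abbrev Zd (d : ℕ) := Fin d → ℤ

/-- Nearest-neighbour adjacency in `ℤ^d`. -/
def adj {d : ℕ} (x y : Zd d) : Prop := (∑ i, (x i - y i).natAbs) = 1

instance {d : ℕ} (x y : Zd d) : Decidable (adj x y) := by unfold adj; infer_instance

/-- `ξ` restricted to `W` is a forbidden subconfiguration (FSC):
every `y ∈ W` has height strictly less than its number of neighbours inside `W`. -/
def IsFSC {d : ℕ} (ξ : Zd d → ℕ) (W : Finset (Zd d)) : Prop :=
  ∀ y ∈ W, ξ y < (W.filter (fun z => adj z y)).card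

/-- `ξ` is allowed on `Λ`: no nonempty `W ⊆ Λ` is a forbidden subconfiguration. -/
def Allowed {d : ℕ} (Λ : Finset (Zd d)) (ξ : Zd d → ℕ) : Prop :=
  ∀ W ⊆ Λ, W.Nonempty → ¬ IsFSC ξ W

/-- The set `U_i` of vertices unburnt at time `i` of the burning algorithm:
`U_0 = Λ`, `U_1 = Λ \ {x : ξ x = 2d}`, and for `i ≥ 2`,
`U_i = U_{i-1} \ B_i` where `B_i = {x ∈ U_{i-1} : ξ x ≥ #{y ∈ U_{i-1} : y ∼ x}}`. -/
def burnU {d : ℕ} (Λ : Finset (Zd d)) (ξ : Zd d → ℕ) : ℕ → Finset (Zd d)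
  | 0 => Λ
  | 1 => Λ.filter (fun x => ξ x ≠ 2*d)
  | (i+2) => (burnU Λ ξ (i+1)).filter
      (fun x => ξ x < ((burnU Λ ξ (i+1)).filter (fun y => adj y x)).card)

theorem adj_eq_update {d : ℕ} {z y : Zd d} (h : adj z y) :
    ∃ p : Fin d × Bool, Function.update y p.1 (y p.1 + if p.2 then 1 else -1) = z := by
  unfold adj at h
  obtain ⟨i, -, hi⟩ : ∃ i ∈ Finset.univ, (z i - y i).natAbs ≠ 0 :=
    Finset.exists_ne_zero_of_sum_ne_zero (by omega)
  have hsum := Finset.add_sum_erase Finset.univ (fun j => (z j - y j).natAbs) (Finset.mem_univ i)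
  have hzero : ∑ j ∈ Finset.univ.erase i, (z j - y j).natAbs = 0 := by
    omega
  have hother : ∀ j, j ≠ i → z j = y j := by
    intro j hj
    have := (Finset.sum_eq_zero_iff.mp hzero) j (by simp [hj])
    omega
  have hone : (z i - y i).natAbs = 1 := by
    omega
  refine ⟨(i, decide (z i = y i + 1)), ?_⟩
  funext j
  by_cases hj : j = i
  · subst hj
    simp only [Function.update_self, decide_eq_true_eq]
    split_ifs <;> omega
  · simp [hj, hother j hj]

theorem card_filter_adj_le {d : ℕ} (W : Finset (Zd d)) (y : Zd d) :
    (W.filter (fun z => adj z y)).card ≤ 2 * d := by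
  calc (W.filter (fun z => adj z y)).card
      ≤ (Finset.univ.image fun p : Fin d × Bool =>
          Function.update y p.1 (y p.1 + if p.2 then 1 else -1)).card := by
        refine Finset.card_le_card fun z hz => ?_
        obtain ⟨p, hp⟩ := adj_eq_update (Finset.mem_filter.mp hz).2
        exact Finset.mem_image.mpr ⟨p, Finset.mem_univ p, hp⟩
    _ ≤ (Finset.univ : Finset (Fin d × Bool)).card := Finset.card_image_le
    _ = 2 * d := by simp [mul_comm]

theorem IsFSC.subset_burnU {d : ℕ} {Λ W : Finset (Zd d)} {ξ : Zd d → ℕ}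
    (hW : IsFSC ξ W) (hsub : W ⊆ Λ) (i : ℕ) : W ⊆ burnU Λ ξ (i + 1) := by
  induction i with
  | zero =>
    intro y hy
    have := (hW y hy).trans_le (card_filter_adj_le W y)
    exact Finset.mem_filter.mpr ⟨hsub hy, this.ne⟩
  | succ i ih =>
    intro y hy
    exact Finset.mem_filter.mpr ⟨ih hy, (hW y hy).trans_le
      (Finset.card_le_card (Finset.filter_subset_filter _ ih))⟩

theorem burnU_succ_subset {d : ℕ} (Λ : Finset (Zd d)) (ξ : Zd d → ℕ) (i : ℕ) :
    burnU Λ ξ (i + 1) ⊆ burnU Λ ξ i := by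
  cases i <;> exact Finset.filter_subset _ _

theorem burnU_subset {d : ℕ} (Λ : Finset (Zd d)) (ξ : Zd d → ℕ) (i : ℕ) :
    burnU Λ ξ i ⊆ Λ := by
  induction i with
  | zero => exact subset_rfl
  | succ i ih => exact (burnU_succ_subset Λ ξ i).trans ih

theorem isFSC_of_burnU_stable {d : ℕ} {Λ : Finset (Zd d)} {ξ : Zd d → ℕ} {i : ℕ}
    (h : burnU Λ ξ (i + 2) = burnU Λ ξ (i + 1)) : IsFSC ξ (burnU Λ ξ (i + 1)) :=
  Finset.filter_eq_self.mp h

/-- The burning test terminates (some `U_i`, `i ≥ 1`, is empty) iff `ξ` is allowed. -/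
theorem burning_test_iff_allowed (d : ℕ) (hd : 1 ≤ d) (Λ : Finset (Zd d))
    (ξ : Zd d → ℕ) (hξ : ∀ x ∈ Λ, ξ x ≤ 2*d) :
    (∃ i : ℕ, 1 ≤ i ∧ burnU Λ ξ i = ∅) ↔ Allowed Λ ξ := by
  constructor
  · rintro ⟨i, hi, hempty⟩ W hsub hne hW
    obtain ⟨j, rfl⟩ := Nat.exists_eq_add_of_le' hi
    exact hne.ne_empty (Finset.subset_empty.mp (hempty ▸ hW.subset_burnU hsub j))
  · intro hallowed
    by_contra! hne
    have hlt : ∀ i, (burnU Λ ξ (i + 2)).card < (burnU Λ ξ (i + 1)).card := fun i =>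
      Finset.card_lt_card ((burnU_succ_subset Λ ξ (i + 1)).ssubset_of_ne fun h =>
        hallowed _ (burnU_subset Λ ξ (i + 1))
          (hne (i + 1) (by omega)) (isFSC_of_burnU_stable h))
    exact not_strictAnti_of_wellFoundedLT (fun i => (burnU Λ ξ (i + 1)).card)
      (strictAnti_nat_of_succ_lt hlt)

end Sandpile0
end

section
/- Let d ≥ 1, let Λ ⊂ Z^d be finite and nonempty, and let γ > 0. Let m^{(γ)}_Λ be normalized Lebesgue measure on the set ℛ^{(γ)}_Λ of allowed configurations in [0, 2d+γ)^Λ, and let ψ_Λ : [0,∞)^Λ → {0,1,…,2d}^Λ be the discretization map (ψ_Λ(η))_x = ⌊η_x⌋ if η_x < 2d and (ψ_Λ(η))_x = 2d if η_x ≥ 2d. Then: (a) a configuration η ∈ [0,2d+γ)^Λ is allowed if and only if ψ_Λ(η) is allowed; and (b) the pushforward ν^{(γ)}_Λ of m^{(γ)}_Λ under ψ_Λ satisfies, for every allowed ξ ∈ {0,1,…,2d}^Λ, ν^{(γ)}_Λ({ξ}) = γ^{H(ξ)} / Σ_{ξ' allowed} γ^{H(ξ')}, where H(ξ) = #{x ∈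 Λ : ξ_x = 2d}. -/
/- STATEMENT 2: Discretization of the continuous dissipative sandpile:
(a) a configuration in `[0, 2d+γ)^Λ` is allowed iff its discretization is allowed;
(b) the pushforward of normalized Lebesgue measure on the allowed configurations
under the discretization map gives each allowed discrete configuration `ξ`
probability `γ^{H(ξ)} / Σ_{ξ' allowed} γ^{H(ξ')}`. -/

open MeasureTheory
open scoped ENNReal

namespace Sandpile2

/-- The lattice `ℤ^d`. -/
abbrev Zd (d : ℕ) := Fin d → ℤ

/-- Nearest-neighbour adjacency in `ℤ^d`. -/
def adj {d : ℕ} (x y : Zd d) : Prop := (∑ i, (x i - y i).natAbs) = 1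

instance {d : ℕ} (x y : Zd d) : Decidable (adj x y) := by unfold adj; infer_instance

variable {d : ℕ} {Λ : Finset (Zd d)}

/-- Forbidden subconfiguration for a real-valued configuration on `Λ`. -/
def IsFSCR (η : ↥Λ → ℝ) (W : Finset ↥Λ) : Prop :=
  ∀ y ∈ W, η y < (W.filter (fun z : ↥Λ => adj (z : Zd d) (y : Zd d))).card

/-- A real-valued configuration on `Λ` is allowed. -/
def AllowedR (η : ↥Λ → ℝ) : Prop := ∀ W : Finset ↥Λ, W.Nonempty → ¬ IsFSCR η W

/-- Forbidden subconfiguration for an integer-valued configuration on `Λ`. -/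
def IsFSCN (ξ : ↥Λ → ℕ) (W : Finset ↥Λ) : Prop :=
  ∀ y ∈ W, ξ y < (W.filter (fun z : ↥Λ => adj (z : Zd d) (y : Zd d))).card

/-- An integer-valued configuration on `Λ` is allowed. -/
def AllowedN (ξ : ↥Λ → ℕ) : Prop := ∀ W : Finset ↥Λ, W.Nonempty → ¬ IsFSCN ξ W

/-- The discretization map `ψ_Λ`: heights below `2d` are replaced by their integer
parts, heights `≥ 2d` by `2d`. -/
noncomputable def disc (d : ℕ) (η : ↥Λ → ℝ) : ↥Λ → ℕ :=
  fun x => if η x < 2*d then ⌊η x⌋₊ else 2*d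

/-- The set of allowed configurations in `[0, 2d+γ)^Λ`. -/
def RSet (d : ℕ) (γ : ℝ) (Λ : Finset (Zd d)) : Set (↥Λ → ℝ) :=
  {η | (∀ x, 0 ≤ η x ∧ η x < 2*d + γ) ∧ AllowedR η}

/-- `m^{(γ)}_Λ`: normalized Lebesgue measure on the allowed configurations
in `[0, 2d+γ)^Λ`. -/
noncomputable def mMeas (d : ℕ) (γ : ℝ) (Λ : Finset (Zd d)) : Measure (↥Λ → ℝ) :=
  (volume (RSet d γ Λ))⁻¹ • volume.restrict (RSet d γ Λ)

/-- The number of sites at maximal height `2d`. -/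
def H (d : ℕ) (ξ : ↥Λ → ℕ) : ℕ := (Finset.univ.filter (fun x => ξ x = 2*d)).card

/-- All configurations in `{0,…,2d}^Λ`, as a finset of functions. -/
def cfgs (d : ℕ) (Λ : Finset (Zd d)) : Finset (↥Λ → ℕ) :=
  Fintype.piFinset (fun _ => Finset.range (2*d + 1))

lemma exists_eq_add_single_of_adj {d : ℕ} {z y : Zd d} (h : adj z y) :
    ∃ p : Fin d × Bool, y + Pi.single p.1 (if p.2 then 1 else -1) = z := by
  obtain ⟨i, -, hi⟩ : ∃ i ∈ Finset.univ, (z i - y i).natAbs ≠ 0 :=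
    Finset.exists_ne_zero_of_sum_ne_zero (by rw [show _ = 1 from h]; exact one_ne_zero)
  have hsplit := Finset.add_sum_erase Finset.univ (fun j => (z j - y j).natAbs) (Finset.mem_univ i)
  rw [show _ = 1 from h] at hsplit
  have hzero : ∀ j, j ≠ i → z j = y j := fun j hj => by
    have hle := Finset.single_le_sum (f := fun j => (z j - y j).natAbs) (fun _ _ => Nat.zero_le _)
      (Finset.mem_erase.2 ⟨hj, Finset.mem_univ j⟩)
    omega
  refine ⟨(i, decide (y i < z i)), funext fun j => ?_⟩
  by_cases hj : j = i
  · subst hj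
    simp only [Pi.add_apply, Pi.single_eq_same, decide_eq_true_eq]
    split_ifs <;> omega
  · simp [hj, hzero j hj]

lemma card_adj_le {d : ℕ} {Λ : Finset (Zd d)} (W : Finset ↥Λ) (y : Zd d) :
    (W.filter (fun z : ↥Λ => adj (z : Zd d) y)).card ≤ 2 * d := by
  calc (W.filter (fun z : ↥Λ => adj (z : Zd d) y)).card
      ≤ (Finset.univ.image
          (fun p : Fin d × Bool => y + Pi.single p.1 (if p.2 then 1 else -1))).card := by
        refine Finset.card_le_card_of_injOn (fun z => (z : Zd d)) (fun z hz => ?_)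
          Subtype.val_injective.injOn
        obtain ⟨p, hp⟩ := exists_eq_add_single_of_adj (Finset.mem_filter.1 hz).2
        exact Finset.mem_coe.2 (Finset.mem_image.2 ⟨p, Finset.mem_univ _, hp⟩)
    _ ≤ (Finset.univ : Finset (Fin d × Bool)).card := Finset.card_image_le
    _ = 2 * d := by simp [mul_comm]

/-- Discretizing a height does not change which thresholds up to `2d` lie above it. -/
lemma disc_lt_iff {d : ℕ} {Λ : Finset (Zd d)} {η : ↥Λ → ℝ} {x : ↥Λ} (h0 : 0 ≤ η x) {n : ℕ}
    (hn : n ≤ 2 * d) : disc d η x < n ↔ η x < n := by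
  unfold disc
  split_ifs with h
  · exact Nat.floor_lt h0
  · have : (n : ℝ) ≤ 2 * d := by exact_mod_cast hn
    exact iff_of_false (by omega) (by linarith)

lemma allowedR_iff_allowedN_disc {d : ℕ} {Λ : Finset (Zd d)} {η : ↥Λ → ℝ} (h0 : ∀ x, 0 ≤ η x) :
    AllowedR η ↔ AllowedN (disc d η) := by
  refine forall₂_congr fun W _ => not_congr (forall₂_congr fun y _ => ?_)
  exact (disc_lt_iff (h0 y) (card_adj_le W y)).symm

lemma measurable_disc {d : ℕ} {Λ : Finset (Zd d)} :
    Measurable (disc d : (↥Λ → ℝ) → ↥Λ → ℕ) := by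
  refine measurable_pi_lambda _ fun x => ?_
  exact Measurable.ite (measurableSet_lt (measurable_pi_apply x) measurable_const)
    (Nat.measurable_floor.comp (measurable_pi_apply x)) measurable_const

lemma disc_le {d : ℕ} {Λ : Finset (Zd d)} (η : ↥Λ → ℝ) (x : ↥Λ) : disc d η x ≤ 2 * d := by
  unfold disc
  split_ifs with h
  · exact Nat.floor_le_of_le (by exact_mod_cast h.le)
  · exact le_rfl

/-- The box of configurations in `[0, 2d+γ)^Λ` whose discretization is `ξ`. -/
def cell (d : ℕ) (γ : ℝ) {Λ : Finset (Zd d)} (ξ : ↥Λ → ℕ) : Set (↥Λ → ℝ) :=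
  Set.univ.pi fun x => Set.Ico (ξ x : ℝ) (ξ x + if ξ x = 2 * d then γ else 1)

lemma measurableSet_cell {d : ℕ} {γ : ℝ} {Λ : Finset (Zd d)} (ξ : ↥Λ → ℕ) :
    MeasurableSet (cell d γ ξ) :=
  MeasurableSet.univ_pi fun _ => measurableSet_Ico

lemma volume_cell {d : ℕ} {γ : ℝ} (hγ : 0 < γ) {Λ : Finset (Zd d)} (ξ : ↥Λ → ℕ) :
    volume (cell d γ ξ) = ENNReal.ofReal (γ ^ H d ξ) := by
  rw [cell, Real.volume_pi_Ico, ← ENNReal.ofReal_prod_of_nonneg]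
  · simp [H, Finset.prod_ite]
  · intro x _
    split_ifs <;> simp [hγ.le]

lemma mem_cell_iff {d : ℕ} {γ : ℝ} (hγ : 0 < γ) {Λ : Finset (Zd d)} {ξ : ↥Λ → ℕ}
    (hξ : ∀ x, ξ x ≤ 2 * d) {η : ↥Λ → ℝ} :
    η ∈ cell d γ ξ ↔ (∀ x, 0 ≤ η x ∧ η x < 2 * d + γ) ∧ disc d η = ξ := by
  rw [cell, Set.mem_univ_pi, funext_iff, ← forall_and]
  refine forall_congr' fun x => ?_
  have hc : (ξ x : ℝ) ≤ 2 * d := by exact_mod_cast hξ x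
  have hp : (0 : ℝ) ≤ ξ x := Nat.cast_nonneg _
  rw [Set.mem_Ico, disc]
  rcases (hξ x).eq_or_lt with h | h
  · have hr : (ξ x : ℝ) = 2 * d := by exact_mod_cast h
    rw [if_pos h, hr]
    constructor
    · rintro ⟨h1, h2⟩
      exact ⟨⟨by linarith, h2⟩, by rw [if_neg h1.not_gt, h]⟩
    · rintro ⟨⟨h0, h2⟩, h3⟩
      refine ⟨not_lt.1 fun hlt => ?_, h2⟩
      rw [if_pos hlt, h, Nat.floor_eq_iff h0] at h3
      push_cast at h3
      linarith
  · have hr : (ξ x : ℝ) + 1 ≤ 2 * d := by exact_mod_cast h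
    rw [if_neg h.ne]
    constructor
    · rintro ⟨h1, h2⟩
      refine ⟨⟨by linarith, by linarith⟩, ?_⟩
      rw [if_pos (by linarith), Nat.floor_eq_iff (by linarith)]
      exact ⟨h1, h2⟩
    · rintro ⟨⟨h0, -⟩, h3⟩
      split_ifs at h3
      · exact (Nat.floor_eq_iff h0).1 h3
      · omega

lemma mem_cfgs {d : ℕ} {Λ : Finset (Zd d)} {ξ : ↥Λ → ℕ} :
    ξ ∈ cfgs d Λ ↔ ∀ x, ξ x ≤ 2 * d := by
  simp [cfgs]

open scoped Classical in
lemma RSet_eq_biUnion_cell {d : ℕ} {γ : ℝ} (hγ : 0 < γ) {Λ : Finset (Zd d)} :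
    RSet d γ Λ = ⋃ ξ ∈ (cfgs d Λ).filter AllowedN, cell d γ ξ := by
  ext η
  simp only [Set.mem_iUnion, Finset.mem_filter, mem_cfgs, exists_prop]
  constructor
  · rintro ⟨hη, ha⟩
    exact ⟨disc d η, ⟨disc_le η, (allowedR_iff_allowedN_disc fun x => (hη x).1).1 ha⟩,
      (mem_cell_iff hγ (disc_le η)).2 ⟨hη, rfl⟩⟩
  · rintro ⟨ξ, ⟨hξ, ha⟩, hmem⟩
    obtain ⟨hη, rfl⟩ := (mem_cell_iff hγ hξ).1 hmem
    exact ⟨hη, (allowedR_iff_allowedN_disc fun x => (hη x).1).2 ha⟩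

open scoped Classical in
lemma volume_RSet {d : ℕ} {γ : ℝ} (hγ : 0 < γ) {Λ : Finset (Zd d)} :
    volume (RSet d γ Λ) =
      ENNReal.ofReal (∑ ξ ∈ cfgs d Λ, if AllowedN ξ then γ ^ H d ξ else 0) := by
  rw [RSet_eq_biUnion_cell hγ, measure_biUnion_finset _ fun ξ _ => measurableSet_cell ξ,
    ← Finset.sum_filter, ENNReal.ofReal_sum_of_nonneg fun ξ _ => by positivity]
  · exact Finset.sum_congr rfl fun ξ _ => volume_cell hγ ξ
  · intro ξ hξ ξ' hξ' hne
    refine Set.disjoint_left.2 fun η h h' => hne ?_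
    rw [Finset.mem_coe, Finset.mem_filter, mem_cfgs] at hξ hξ'
    rw [← ((mem_cell_iff hγ hξ.1).1 h).2, ((mem_cell_iff hγ hξ'.1).1 h').2]

lemma disc_preimage_inter_RSet {d : ℕ} {γ : ℝ} (hγ : 0 < γ) {Λ : Finset (Zd d)} {ξ : ↥Λ → ℕ}
    (hξ : ∀ x, ξ x ≤ 2 * d) (ha : AllowedN ξ) :
    disc d ⁻¹' {ξ} ∩ RSet d γ Λ = cell d γ ξ := by
  ext η
  rw [mem_cell_iff hγ hξ]
  constructor
  · rintro ⟨h, hη, -⟩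
    exact ⟨hη, h⟩
  · rintro ⟨hη, rfl⟩
    exact ⟨rfl, hη, (allowedR_iff_allowedN_disc fun x => (hη x).1).2 ha⟩

open scoped Classical in
/-- Discretization commutes with allowedness, and the discretized measure
`ν^{(γ)}_Λ` weights allowed configurations by `γ^{H(ξ)}`. -/
theorem discretization (d : ℕ) (hd : 1 ≤ d) (Λ : Finset (Zd d)) (hΛ : Λ.Nonempty)
    (γ : ℝ) (hγ : 0 < γ) :
    (∀ η : ↥Λ → ℝ, (∀ x, 0 ≤ η x ∧ η x < 2*d + γ) →
      (AllowedR η ↔ AllowedN (disc d η))) ∧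
    (∀ ξ : ↥Λ → ℕ, (∀ x, ξ x ≤ 2*d) → AllowedN ξ →
      (mMeas d γ Λ).map (disc d) {ξ} =
        ENNReal.ofReal (γ ^ (H d ξ) /
          ∑ ξ' ∈ cfgs d Λ, if AllowedN ξ' then γ ^ (H d ξ') else 0)) := by
  refine ⟨fun η hη => allowedR_iff_allowedN_disc fun x => (hη x).1, fun ξ hξ ha => ?_⟩
  have hS : 0 < ∑ ξ' ∈ cfgs d Λ, if AllowedN ξ' then γ ^ H d ξ' else 0 := by
    refine Finset.sum_pos' (fun ξ' _ => by positivity) ⟨ξ, mem_cfgs.2 hξ, ?_⟩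
    rw [if_pos ha]
    positivity
  rw [Measure.map_apply measurable_disc (measurableSet_singleton ξ), mMeas, Measure.smul_apply,
    Measure.restrict_apply (measurable_disc (measurableSet_singleton ξ)),
    disc_preimage_inter_RSet hγ hξ ha, volume_cell hγ, volume_RSet hγ, smul_eq_mul,
    ENNReal.ofReal_div_of_pos hS, ENNReal.div_eq_inv_mul]

end Sandpile2
end

section
/- Let d ≥ 1, let Λ ⊂ Z^d be finite and nonempty, and let γ > 0. Let m^{(γ)}_Λ be normalized Lebesgue measure on the set of allowed configurations in [0, 2d+γ)^Λ, ψ_Λ the discretization map, and ν^{(γ)}_Λ the pushforward of m^{(γ)}_Λ under ψ_Λ. Write I(h) = [h, h+1) for h ∈ {0,…,2d−1} and I(2d) = [2d, 2d+γ). Then for every allowed ξ ∈ {0,1,…,2d}^Λ and every family of Borel sets E_x ⊆ I(ξ_x), x ∈ Λ: m^{(γ)}_Λ({η : η_x ∈ E_x for all x ∈ Λ}) = ν^{(γ)}_Λ({ξ}) · ∏_{x ∈ Λ} Leb(E_x)/Leb(I(ξ_x)). In other words, under m^{(γ)}_Λ, conditionally on ψ_Λ(η) = ξ, the coordinates (η_x)_{x∈Λ}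 are independent, with η_x uniform on I(ξ_x). -/
/- STATEMENT 3: The uniformity property: under `m^{(γ)}_Λ`, conditionally on the
discretization `ψ_Λ(η) = ξ`, the coordinates `η_x` are independent and uniform on
their respective intervals `I(ξ_x)`. -/

open MeasureTheory
open scoped ENNReal

namespace Sandpile3

/-- The lattice `ℤ^d`. -/
abbrev Zd (d : ℕ) := Fin d → ℤ

/-- Nearest-neighbour adjacency in `ℤ^d`. -/
def adj {d : ℕ} (x y : Zd d) : Prop := (∑ i, (x i - y i).natAbs) = 1

instance {d : ℕ} (x y : Zd d) : Decidable (adj x y) := by unfold adj; infer_instance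

variable {d : ℕ} {Λ : Finset (Zd d)}

/-- Forbidden subconfiguration for a real-valued configuration on `Λ`. -/
def IsFSCR (η : ↥Λ → ℝ) (W : Finset ↥Λ) : Prop :=
  ∀ y ∈ W, η y < (W.filter (fun z : ↥Λ => adj (z : Zd d) (y : Zd d))).card

/-- A real-valued configuration on `Λ` is allowed. -/
def AllowedR (η : ↥Λ → ℝ) : Prop := ∀ W : Finset ↥Λ, W.Nonempty → ¬ IsFSCR η W

/-- Forbidden subconfiguration for an integer-valued configuration on `Λ`. -/
def IsFSCN (ξ : ↥Λ → ℕ) (W : Finset ↥Λ) : Prop :=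
  ∀ y ∈ W, ξ y < (W.filter (fun z : ↥Λ => adj (z : Zd d) (y : Zd d))).card

/-- An integer-valued configuration on `Λ` is allowed. -/
def AllowedN (ξ : ↥Λ → ℕ) : Prop := ∀ W : Finset ↥Λ, W.Nonempty → ¬ IsFSCN ξ W

/-- The discretization map `ψ_Λ`: heights below `2d` are replaced by their integer
parts, heights `≥ 2d` by `2d`. -/
noncomputable def disc (d : ℕ) (η : ↥Λ → ℝ) : ↥Λ → ℕ :=
  fun x => if η x < 2*d then ⌊η x⌋₊ else 2*d

/-- The set of allowed configurations in `[0, 2d+γ)^Λ`. -/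
def RSet (d : ℕ) (γ : ℝ) (Λ : Finset (Zd d)) : Set (↥Λ → ℝ) :=
  {η | (∀ x, 0 ≤ η x ∧ η x < 2*d + γ) ∧ AllowedR η}

/-- `m^{(γ)}_Λ`: normalized Lebesgue measure on the allowed configurations
in `[0, 2d+γ)^Λ`. -/
noncomputable def mMeas (d : ℕ) (γ : ℝ) (Λ : Finset (Zd d)) : Measure (↥Λ → ℝ) :=
  (volume (RSet d γ Λ))⁻¹ • volume.restrict (RSet d γ Λ)

/-- The number of sites at maximal height `2d`. -/
def H (d : ℕ) (ξ : ↥Λ → ℕ) : ℕ := (Finset.univ.filter (fun x => ξ x = 2*d)).card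

/-- All configurations in `{0,…,2d}^Λ`, as a finset of functions. -/
def cfgs (d : ℕ) (Λ : Finset (Zd d)) : Finset (↥Λ → ℕ) :=
  Fintype.piFinset (fun _ => Finset.range (2*d + 1))


/-- The interval `I(h)`: `[h, h+1)` for `h < 2d` and `[2d, 2d+γ)` for `h = 2d`. -/
noncomputable def I (d : ℕ) (γ : ℝ) (h : ℕ) : Set ℝ :=
  if h = 2*d then Set.Ico (2*d : ℝ) (2*d + γ) else Set.Ico (h : ℝ) (h + 1)

lemma measurableSet_I (d : ℕ) (γ : ℝ) (h : ℕ) : MeasurableSet (I d γ h) := by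
  unfold I
  split_ifs <;> exact measurableSet_Ico

lemma volume_I_ne_zero (d : ℕ) {γ : ℝ} (hγ : 0 < γ) (h : ℕ) : volume (I d γ h) ≠ 0 := by
  unfold I
  split_ifs <;> simp [Real.volume_Ico, hγ]

lemma volume_I_ne_top (d : ℕ) (γ : ℝ) (h : ℕ) : volume (I d γ h) ≠ ∞ := by
  unfold I
  split_ifs <;> simp [Real.volume_Ico]

lemma measurable_disc (d : ℕ) : Measurable (disc (Λ := Λ) d) := by
  refine measurable_pi_lambda _ fun x => ?_
  exact Measurable.ite (measurableSet_lt (measurable_pi_apply x) measurable_const)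
    (Nat.measurable_floor.comp (measurable_pi_apply x)) measurable_const

lemma natCast_le_of_mem_I {γ t : ℝ} {h : ℕ} (ht : t ∈ I d γ h) : (h : ℝ) ≤ t := by
  unfold I at ht
  split_ifs at ht with hh
  · subst hh
    push_cast
    exact ht.1
  · exact ht.1

/-- On `[0, 2d+γ)`, the interval `I(h)` is the set of heights with discretization `h`. -/
lemma mem_I_iff {γ t : ℝ} (hγ : 0 < γ) {h : ℕ} (hh : h ≤ 2 * d) :
    t ∈ I d γ h ↔
      (0 ≤ t ∧ t < 2 * d + γ) ∧ (if t < 2 * d then ⌊t⌋₊ else 2 * d) = h := by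
  have hd0 : (0 : ℝ) ≤ d := d.cast_nonneg
  unfold I
  split_ifs with h1 h2 h2
  · constructor
    · rintro ⟨h3, -⟩
      linarith
    · rintro ⟨⟨h3, -⟩, h4⟩
      have h5 := Nat.floor_le h3
      rw [h4, h1] at h5
      push_cast at h5
      linarith
  · simp only [Set.mem_Ico, h1, and_true]
    constructor <;> rintro ⟨h3, h4⟩ <;> constructor <;> linarith
  · constructor
    · rintro ⟨h3, h4⟩
      have h5 : 0 ≤ t := h.cast_nonneg.trans h3
      exact ⟨⟨h5, by linarith⟩, (Nat.floor_eq_iff h5).2 ⟨h3, h4⟩⟩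
    · rintro ⟨⟨h3, -⟩, h4⟩
      exact (Nat.floor_eq_iff h3).1 h4
  · constructor
    · rintro ⟨-, h3⟩
      have h4 : (h : ℝ) + 1 ≤ 2 * d := by exact_mod_cast (by omega : h + 1 ≤ 2 * d)
      linarith
    · rintro ⟨-, h3⟩
      exact absurd h3.symm h1

lemma AllowedN.allowedR {ξ : ↥Λ → ℕ} {η : ↥Λ → ℝ} (ha : AllowedN ξ) (h : ∀ x, (ξ x : ℝ) ≤ η x) :
    AllowedR η :=
  fun W hW hη => ha W hW fun y hy => by exact_mod_cast (h y).trans_lt (hη y hy)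

lemma disc_preimage_inter_RSet {γ : ℝ} (hγ : 0 < γ) {ξ : ↥Λ → ℕ} (hb : ∀ x, ξ x ≤ 2 * d)
    (ha : AllowedN ξ) :
    disc d ⁻¹' {ξ} ∩ RSet d γ Λ = Set.univ.pi fun x => I d γ (ξ x) := by
  ext η
  simp only [Set.mem_inter_iff, Set.mem_preimage, Set.mem_singleton_iff, Set.mem_univ_pi]
  constructor
  · rintro ⟨h1, h2, -⟩ x
    exact (mem_I_iff hγ (hb x)).2 ⟨h2 x, congrFun h1 x⟩
  · intro h
    exact ⟨funext fun x => ((mem_I_iff hγ (hb x)).1 (h x)).2,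
      fun x => ((mem_I_iff hγ (hb x)).1 (h x)).1,
      ha.allowedR fun x => natCast_le_of_mem_I (h x)⟩

/-- Uniformity property of `m^{(γ)}_Λ` given the discretization. -/
theorem uniformity (d : ℕ) (hd : 1 ≤ d) (Λ : Finset (Zd d)) (hΛ : Λ.Nonempty)
    (γ : ℝ) (hγ : 0 < γ) (ξ : ↥Λ → ℕ) (hb : ∀ x, ξ x ≤ 2*d) (ha : AllowedN ξ)
    (E : ↥Λ → Set ℝ) (hEm : ∀ x, MeasurableSet (E x)) (hEsub : ∀ x, E x ⊆ I d γ (ξ x)) :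
    mMeas d γ Λ {η | ∀ x, η x ∈ E x} =
      ((mMeas d γ Λ).map (disc d)) {ξ} *
        ∏ x : ↥Λ, volume (E x) / volume (I d γ (ξ x)) := by
  have hE : {η : ↥Λ → ℝ | ∀ x, η x ∈ E x} = Set.univ.pi E := by
    ext η
    simp
  have hsub : Set.univ.pi E ⊆ RSet d γ Λ :=
    (Set.pi_mono fun x _ => hEsub x).trans
      ((disc_preimage_inter_RSet hγ hb ha).symm.subset.trans Set.inter_subset_right)
  have hprod : ∏ x, volume (E x) =
      (∏ x, volume (I d γ (ξ x))) * ∏ x, volume (E x) / volume (I d γ (ξ x)) := by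
    rw [← Finset.prod_mul_distrib]
    exact Finset.prod_congr rfl fun x _ =>
      (ENNReal.mul_div_cancel (volume_I_ne_zero d hγ _) (volume_I_ne_top d γ _)).symm
  have hmeas : MeasurableSet (disc d ⁻¹' {ξ}) :=
    measurable_disc d (measurableSet_singleton ξ)
  rw [hE, Measure.map_apply (measurable_disc d) (measurableSet_singleton ξ), mMeas,
    Measure.smul_apply, Measure.smul_apply, Measure.restrict_apply (MeasurableSet.univ_pi hEm),
    Measure.restrict_apply hmeas, Set.inter_eq_left.2 hsub, disc_preimage_inter_RSet hγ hb ha,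
    volume_pi_pi, volume_pi_pi, hprod, smul_eq_mul, smul_eq_mul, mul_assoc]

end Sandpile3
end
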